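/- For real a, b > 0, the integral over x from 0 to ∞ of (√(√(x²+a²)+a)/x)·sin(bx) equals √(π/(2b))·e^{-ab} + √(a/2)·π·erf(√(ab)). -/

import Mathlib

open Real MeasureTheory Filter

noncomputable def erf (z : ℝ) : ℝ := (2 / Real.sqrt π) * ∫ u in (0:ℝ)..z, Real.exp (-u^2)

open Set Topology

/-- The sine integral `Si`. -/
noncomputable def sineIntegral (y : ℝ) : ℝ := ∫ x in (0:ℝ)..y, sinc x

lemma continuous_sineIntegral : Continuous sineIntegral :=
  intervalIntegral.continuous_primitive (fun _ _ => continuous_sinc.intervalIntegrable _ _) 0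

lemma sineIntegral_neg (y : ℝ) : sineIntegral (-y) = -sineIntegral y := by
  have h := intervalIntegral.integral_comp_neg (a := 0) (b := y) sinc
  simp only [sinc_neg, neg_zero] at h
  rw [sineIntegral, sineIntegral, intervalIntegral.integral_symm, h]

lemma integral_mul_sinc (c R : ℝ) : ∫ x in (0:ℝ)..R, c * sinc (c * x) = sineIntegral (c * R) := by
  rw [intervalIntegral.integral_const_mul, sineIntegral]
  simp

lemma abs_sineIntegral_sub_le {m u v : ℝ} (hm : 0 < m) (hu : m ≤ u) (hv : m ≤ v) :
    |sineIntegral u - sineIntegral v| ≤ |u - v| / m := by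
  have h : sineIntegral u - sineIntegral v = ∫ x in v..u, sinc x :=
    intervalIntegral.integral_interval_sub_left (continuous_sinc.intervalIntegrable _ _)
      (continuous_sinc.intervalIntegrable _ _)
  rw [h, ← Real.norm_eq_abs, div_eq_inv_mul]
  refine intervalIntegral.norm_integral_le_of_norm_le_const fun x hx => ?_
  have hx : m ≤ x := (le_min hv hu).trans hx.1.le
  have hx0 : 0 < x := hm.trans_le hx
  rw [sinc_of_ne_zero hx0.ne', norm_div, Real.norm_eq_abs, Real.norm_eq_abs, abs_of_pos hx0,
    ← one_div]
  exact div_le_div₀ zero_le_one (abs_sin_le_one x) hm hx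

lemma integral_sin_mul_exp_neg (t y : ℝ) :
    ∫ x in (0:ℝ)..y, sin x * exp (-x * t)
      = (1 + t ^ 2)⁻¹ - exp (-y * t) * (cos y + t * sin y) / (1 + t ^ 2) := by
  have ht : 1 + t ^ 2 ≠ 0 := by positivity
  have hd (x : ℝ) : HasDerivAt (fun x => -(exp (-x * t) * (cos x + t * sin x) / (1 + t ^ 2)))
      (sin x * exp (-x * t)) x := by
    have h1 : HasDerivAt (fun x : ℝ => exp (-x * t)) (exp (-x * t) * (-1 * t)) x :=
      (((hasDerivAt_id x).neg).mul_const t).exp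
    have h2 : HasDerivAt (fun x => cos x + t * sin x) (-sin x + t * cos x) x :=
      (hasDerivAt_cos x).add ((hasDerivAt_sin x).const_mul t)
    convert! ((h1.mul h2).div_const (1 + t ^ 2)).neg using 1
    field_simp
    ring
  rw [intervalIntegral.integral_eq_sub_of_hasDerivAt (fun x _ => hd x)
    (Continuous.intervalIntegrable (by fun_prop) _ _)]
  simp
  ring

lemma integral_exp_neg_mul {x : ℝ} (hx : 0 < x) : ∫ t in Ioi (0:ℝ), exp (-x * t) = x⁻¹ := by
  rw [integral_exp_mul_Ioi (neg_neg_of_pos hx)]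
  simp

lemma sineIntegral_eq_integral {y : ℝ} (hy : 0 < y) :
    sineIntegral y = ∫ t in Ioi (0:ℝ),
      ((1 + t ^ 2)⁻¹ - exp (-y * t) * (cos y + t * sin y) / (1 + t ^ 2)) := by
  have hint : Integrable (Function.uncurry fun x t : ℝ => sin x * exp (-x * t))
      ((volume.restrict (Ioc 0 y)).prod (volume.restrict (Ioi 0))) := by
    rw [integrable_prod_iff (by
      apply Continuous.aestronglyMeasurable; unfold Function.uncurry; fun_prop)]
    constructor
    · filter_upwards [ae_restrict_mem measurableSet_Ioc] with x hx
      exact (integrableOn_exp_mul_Ioi (neg_neg_of_pos hx.1) 0).const_mul (sin x)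
    · refine Integrable.congr (f := fun x => |sinc x|)
        (continuous_sinc.abs.integrableOn_Ioc) ?_
      filter_upwards [ae_restrict_mem measurableSet_Ioc] with x hx
      simp only [Function.uncurry, norm_mul, norm_eq_abs, abs_exp]
      rw [integral_const_mul, integral_exp_neg_mul hx.1, sinc_of_ne_zero hx.1.ne', abs_div,
        abs_of_pos hx.1, div_eq_mul_inv]
  have hswap := integral_integral_swap hint
  simp_rw [← intervalIntegral.integral_of_le hy.le (μ := volume), integral_sin_mul_exp_neg] at hswap
  rw [← hswap, sineIntegral, intervalIntegral.integral_of_le hy.le,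
    intervalIntegral.integral_of_le hy.le]
  refine setIntegral_congr_fun measurableSet_Ioc fun x hx => ?_
  rw [integral_const_mul, integral_exp_neg_mul hx.1, sinc_of_ne_zero hx.1.ne', div_eq_mul_inv]

lemma abs_sineIntegral_sub_pi_div_two_le {y : ℝ} (hy : 0 < y) :
    |sineIntegral y - π / 2| ≤ 2 / y := by
  have hexp : IntegrableOn (fun t => 2 * exp (-y * t)) (Ioi 0) :=
    (integrableOn_exp_mul_Ioi (neg_neg_of_pos hy) 0).const_mul 2
  have hbound (t : ℝ) (ht : t ∈ Ioi (0:ℝ)) :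
      ‖exp (-y * t) * (cos y + t * sin y) / (1 + t ^ 2)‖ ≤ 2 * exp (-y * t) := by
    have ht : 0 < t := ht
    rw [norm_div, norm_mul, norm_eq_abs, abs_exp, norm_eq_abs, norm_eq_abs,
      abs_of_pos (by positivity : 0 < 1 + t ^ 2), div_le_iff₀ (by positivity)]
    have h1 : |cos y + t * sin y| ≤ 2 * (1 + t ^ 2) := by
      have h2 : |t * sin y| ≤ t := by
        rw [abs_mul, abs_of_pos ht]
        exact mul_le_of_le_one_right ht.le (abs_sin_le_one y)
      have h3 := abs_add_le (cos y) (t * sin y)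
      have h4 := abs_cos_le_one y
      nlinarith [sq_nonneg (t - 1)]
    nlinarith [exp_pos (-y * t)]
  have hrem : IntegrableOn (fun t => exp (-y * t) * (cos y + t * sin y) / (1 + t ^ 2)) (Ioi 0) := by
    refine Integrable.mono' hexp ?_ ((ae_restrict_mem measurableSet_Ioi).mono hbound)
    exact (Continuous.div (by fun_prop) (by fun_prop)
      (fun t => by positivity)).aestronglyMeasurable
  rw [sineIntegral_eq_integral hy, integral_sub integrable_inv_one_add_sq.integrableOn hrem,
    integral_Ioi_inv_one_add_sq, arctan_zero, sub_zero, sub_sub_cancel_left, abs_neg,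
    ← norm_eq_abs]
  refine (norm_integral_le_of_norm_le hexp
    ((ae_restrict_mem measurableSet_Ioi).mono hbound)).trans_eq ?_
  rw [integral_const_mul, integral_exp_neg_mul hy, div_eq_mul_inv]

lemma abs_sineIntegral_le (y : ℝ) : |sineIntegral y| ≤ 4 := by
  wlog hy : 0 ≤ y generalizing y
  · simpa [sineIntegral_neg] using this (-y) (by linarith)
  rcases le_total y 1 with h | h
  · have := intervalIntegral.norm_integral_le_of_norm_le_const (a := 0) (b := y) (f := sinc)
      (C := 1) fun x _ => abs_sinc_le_one x
    rw [norm_eq_abs, sub_zero, abs_of_nonneg hy] at this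
    exact this.trans (by linarith)
  · have h1 := abs_sineIntegral_sub_pi_div_two_le (zero_lt_one.trans_le h)
    have h2 : 2 / y ≤ 2 := div_le_self zero_le_two h
    rw [abs_le] at h1 ⊢
    constructor <;> linarith [pi_pos, pi_le_four, h1.1, h1.2]

/-- The Dirichlet integral. -/
lemma tendsto_sineIntegral_atTop : Tendsto sineIntegral atTop (𝓝 (π / 2)) := by
  rw [tendsto_iff_norm_sub_tendsto_zero]
  refine squeeze_zero' (Eventually.of_forall fun _ => norm_nonneg _) ?_
    (tendsto_const_nhds.div_atTop tendsto_id : Tendsto (fun y : ℝ => 2 / y) atTop (𝓝 0))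
  filter_upwards [eventually_gt_atTop 0] with y hy
  exact abs_sineIntegral_sub_pi_div_two_le hy

lemma tendsto_sineIntegral_mul_atTop {c : ℝ} (hc : 0 < c) :
    Tendsto (fun R => sineIntegral (c * R)) atTop (𝓝 (π / 2)) :=
  tendsto_sineIntegral_atTop.comp (tendsto_id.const_mul_atTop hc)

lemma norm_one_sub_cexp_neg_le {z : ℂ} (hz : 0 ≤ z.re) : ‖1 - Complex.exp (-z)‖ ≤ ‖z‖ := by
  have h := (convex_halfSpace_re_le 0).norm_image_sub_le_of_norm_hasDerivWithin_le
    (f := Complex.exp) (f' := Complex.exp) (x := -z) (y := 0) (C := 1)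
    (fun w _ => (Complex.hasDerivAt_exp w).hasDerivWithinAt)
    (fun w hw => by rw [Complex.norm_exp]; exact exp_le_one_iff.2 hw) (by simpa using hz) (by simp)
  simpa using h

lemma norm_one_sub_cexp_neg_le_two {z : ℂ} (hz : 0 ≤ z.re) : ‖1 - Complex.exp (-z)‖ ≤ 2 := by
  refine (norm_sub_le _ _).trans ?_
  rw [norm_one, Complex.norm_exp, Complex.neg_re]
  have := exp_le_one_iff.2 (neg_nonpos.2 hz)
  linarith

lemma div_sq_le_of_le {N A B s : ℝ} (h1 : N ≤ A * s ^ 2) (h2 : N ≤ B) (hA : 0 ≤ A) (hB : 0 ≤ B) :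
    N / s ^ 2 ≤ (A + B) * (1 + s ^ 2)⁻¹ := by
  rcases eq_or_ne s 0 with rfl | hs
  · simp only [ne_eq, OfNat.ofNat_ne_zero, not_false_eq_true, zero_pow, div_zero]
    positivity
  · rw [← div_eq_mul_inv, div_le_div_iff₀ (by positivity) (by positivity)]
    nlinarith [sq_nonneg s]

section
variable {z : ℂ}

lemma re_mul_sq_nonneg (hz : 0 ≤ z.re) (s : ℝ) : 0 ≤ (z * (s : ℂ) ^ 2).re := by
  rw [← Complex.ofReal_pow, Complex.re_mul_ofReal]
  positivity

lemma norm_one_sub_cexp_neg_mul_sq_le (hz : 0 ≤ z.re) (s : ℝ) :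
    ‖1 - Complex.exp (-z * s ^ 2)‖ ≤ ‖z‖ * s ^ 2 := by
  rw [neg_mul]
  refine (norm_one_sub_cexp_neg_le (re_mul_sq_nonneg hz s)).trans_eq ?_
  simp

lemma norm_one_sub_cexp_neg_mul_sq_le_two (hz : 0 ≤ z.re) (s : ℝ) :
    ‖1 - Complex.exp (-z * s ^ 2)‖ ≤ 2 := by
  rw [neg_mul]
  exact norm_one_sub_cexp_neg_le_two (re_mul_sq_nonneg hz s)

lemma norm_one_sub_cexp_neg_mul_sq_div_sq_le (hz : 0 ≤ z.re) (s : ℝ) :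
    ‖(1 - Complex.exp (-z * s ^ 2)) / s ^ 2‖ ≤ (‖z‖ + 2) * (1 + s ^ 2)⁻¹ := by
  rw [norm_div, norm_pow, Complex.norm_real, norm_eq_abs, sq_abs]
  exact div_sq_le_of_le (norm_one_sub_cexp_neg_mul_sq_le hz s)
    (norm_one_sub_cexp_neg_mul_sq_le_two hz s) (norm_nonneg _) zero_le_two

lemma integrable_one_sub_cexp_neg_mul_sq_div_sq (hz : 0 ≤ z.re) :
    Integrable fun s : ℝ => (1 - Complex.exp (-z * s ^ 2)) / (s : ℂ) ^ 2 :=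
  (integrable_inv_one_add_sq.const_mul (‖z‖ + 2)).mono'
    (by apply Measurable.aestronglyMeasurable; fun_prop)
    (Eventually.of_forall (norm_one_sub_cexp_neg_mul_sq_div_sq_le hz))

lemma hasDerivAt_one_sub_cexp_neg_mul_sq_div {s : ℝ} (hs : s ≠ 0) :
    HasDerivAt (fun s : ℝ => (1 - Complex.exp (-z * s ^ 2)) / (s : ℂ))
      (2 * z * Complex.exp (-z * s ^ 2) - (1 - Complex.exp (-z * s ^ 2)) / (s : ℂ) ^ 2) s := by
  have hs : (s : ℂ) ≠ 0 := by exact_mod_cast hs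
  have h1 : HasDerivAt (fun s : ℂ => Complex.exp (-z * s ^ 2))
      (Complex.exp (-z * s ^ 2) * (-z * (2 * s))) s := by
    simpa using (((hasDerivAt_id (s : ℂ)).pow 2).const_mul (-z)).cexp
  have h2 := ((h1.const_sub 1).div (hasDerivAt_id (s : ℂ)) hs).comp_ofReal
  convert! h2 using 1
  simp only [id_eq]
  field_simp

lemma continuousAt_one_sub_cexp_neg_mul_sq_div_zero (hz : 0 ≤ z.re) :
    ContinuousAt (fun s : ℝ => (1 - Complex.exp (-z * s ^ 2)) / (s : ℂ)) 0 := by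
  have hbound (s : ℝ) : ‖(1 - Complex.exp (-z * s ^ 2)) / (s : ℂ)‖ ≤ ‖z‖ * |s| := by
    rcases eq_or_ne s 0 with rfl | hs
    · simp
    · rw [norm_div, Complex.norm_real, norm_eq_abs, div_le_iff₀ (abs_pos.2 hs), mul_assoc,
        abs_mul_abs_self, ← sq]
      exact norm_one_sub_cexp_neg_mul_sq_le hz s
  have h0 : Tendsto (fun s : ℝ => ‖z‖ * |s|) (𝓝 0) (𝓝 0) := by
    have : Continuous fun s : ℝ => ‖z‖ * |s| := by fun_prop
    simpa using this.tendsto 0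
  simpa [ContinuousAt] using squeeze_zero_norm hbound h0

lemma tendsto_one_sub_cexp_neg_mul_sq_div_atTop (hz : 0 ≤ z.re) :
    Tendsto (fun s : ℝ => (1 - Complex.exp (-z * s ^ 2)) / (s : ℂ)) atTop (𝓝 0) := by
  refine squeeze_zero_norm' ?_
    (tendsto_const_nhds.div_atTop tendsto_id : Tendsto (fun s : ℝ => 2 / s) atTop (𝓝 0))
  filter_upwards [eventually_gt_atTop 0] with s hs
  rw [norm_div, Complex.norm_real, norm_eq_abs, abs_of_pos hs]
  gcongr
  exact norm_one_sub_cexp_neg_mul_sq_le_two hz s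

lemma mul_pi_div_cpow_half (hz : 0 < z.re) :
    z * (π / z) ^ (1 / 2 : ℂ) = √π * z ^ (2⁻¹ : ℂ) := by
  have hz0 : z ≠ 0 := fun h => by simp [h] at hz
  have harg : z.arg ≠ π := fun h => by
    have := (Complex.arg_eq_pi_iff.1 h).1
    linarith
  have hsq : z ^ (2⁻¹ : ℂ) * z ^ (2⁻¹ : ℂ) = z := by
    rw [← Complex.cpow_add _ _ hz0]
    norm_num
  have hne : z ^ (2⁻¹ : ℂ) ≠ 0 := fun h => by simp [h, eq_comm, hz0] at hsq
  have hπ : ((π : ℂ) * z⁻¹) ^ (2⁻¹ : ℂ) = √π * (z ^ (2⁻¹ : ℂ))⁻¹ := by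
    rw [← Complex.inv_cpow _ _ harg, Complex.cpow_def_of_ne_zero (by simp [hz0, pi_ne_zero]),
      Complex.log_ofReal_mul pi_pos (inv_ne_zero hz0), add_mul, Complex.exp_add,
      ← Complex.cpow_def_of_ne_zero (inv_ne_zero hz0), sqrt_eq_rpow, rpow_def_of_pos pi_pos]
    push_cast
    norm_num
  rw [one_div, div_eq_mul_inv, hπ]
  nth_rw 1 [← hsq]
  field_simp

lemma integral_one_sub_cexp_neg_mul_sq_div_sq (hz : 0 < z.re) :
    ∫ s in Ioi (0:ℝ), (1 - Complex.exp (-z * s ^ 2)) / (s : ℂ) ^ 2 = √π * z ^ (2⁻¹ : ℂ) := by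
  have hg : IntegrableOn (fun s : ℝ => 2 * z * Complex.exp (-z * s ^ 2)) (Ioi 0) :=
    ((integrable_cexp_neg_mul_sq hz).const_mul (2 * z)).integrableOn
  have hq := (integrable_one_sub_cexp_neg_mul_sq_div_sq hz.le).integrableOn (s := Ioi 0)
  have h := integral_Ioi_of_hasDerivAt_of_tendsto
    (continuousAt_one_sub_cexp_neg_mul_sq_div_zero hz.le).continuousWithinAt
    (fun s hs => hasDerivAt_one_sub_cexp_neg_mul_sq_div (ne_of_gt hs)) (hg.sub hq)
    (tendsto_one_sub_cexp_neg_mul_sq_div_atTop hz.le)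
  rw [integral_sub hg hq, integral_const_mul, integral_gaussian_complex_Ioi hz] at h
  rw [← mul_pi_div_cpow_half hz]
  simp only [Complex.ofReal_zero, div_zero, sub_zero] at h
  linear_combination -h

lemma integral_zero_one_sub_cexp_neg_mul_sq_div_sq (hz : 0 ≤ z.re) {c : ℝ} (hc : 0 ≤ c) :
    ∫ s in (0:ℝ)..c, (1 - Complex.exp (-z * s ^ 2)) / (s : ℂ) ^ 2
      = 2 * z * (∫ s in (0:ℝ)..c, Complex.exp (-z * s ^ 2))
        - (1 - Complex.exp (-z * c ^ 2)) / (c : ℂ) := by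
  have hg : IntervalIntegrable (fun s : ℝ => 2 * z * Complex.exp (-z * s ^ 2)) volume 0 c :=
    Continuous.intervalIntegrable (by fun_prop) _ _
  have hq := (integrable_one_sub_cexp_neg_mul_sq_div_sq hz).intervalIntegrable (a := 0) (b := c)
  have h := intervalIntegral.integral_eq_sub_of_hasDerivAt_of_le hc
    (fun s hs => by
      rcases eq_or_ne s 0 with rfl | hs0
      · exact (continuousAt_one_sub_cexp_neg_mul_sq_div_zero hz).continuousWithinAt
      · exact (hasDerivAt_one_sub_cexp_neg_mul_sq_div hs0).continuousAt.continuousWithinAt)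
    (fun s hs => hasDerivAt_one_sub_cexp_neg_mul_sq_div hs.1.ne') (hg.sub hq)
  rw [intervalIntegral.integral_sub hg hq, intervalIntegral.integral_const_mul] at h
  simp only [Complex.ofReal_zero, div_zero, sub_zero] at h
  linear_combination -h

end

lemma re_one_sub_cexp_neg_mul_sq_div_sq (a x s : ℝ) :
    ((1 - Complex.exp (-(a + x * Complex.I) * s ^ 2)) / (s : ℂ) ^ 2).re
      = (1 - exp (-a * s ^ 2) * cos (x * s ^ 2)) / s ^ 2 := by
  rw [← Complex.ofReal_pow, Complex.div_ofReal_re, Complex.sub_re, Complex.exp_re,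
    Complex.re_mul_ofReal, Complex.im_mul_ofReal]
  simp

lemma abs_one_sub_exp_mul_cos_div_sq_le {a : ℝ} (ha : 0 ≤ a) (x s : ℝ) :
    |(1 - exp (-a * s ^ 2) * cos (x * s ^ 2)) / s ^ 2| ≤ (a + |x| + 2) * (1 + s ^ 2)⁻¹ := by
  rw [← re_one_sub_cexp_neg_mul_sq_div_sq]
  refine (Complex.abs_re_le_norm _).trans
    ((norm_one_sub_cexp_neg_mul_sq_div_sq_le (by simpa using ha) s).trans ?_)
  gcongr
  refine (norm_add_le _ _).trans_eq ?_
  simp [abs_of_nonneg ha]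

lemma integral_one_sub_exp_mul_cos_div_sq {a : ℝ} (ha : 0 < a) (x : ℝ) :
    ∫ s in Ioi (0:ℝ), (1 - exp (-a * s ^ 2) * cos (x * s ^ 2)) / s ^ 2
      = √(π / 2) * √(√(x ^ 2 + a ^ 2) + a) := by
  have hre : 0 < ((a : ℂ) + x * Complex.I).re := by simpa using ha
  have h := integral_re
    ((integrable_one_sub_cexp_neg_mul_sq_div_sq hre.le).integrableOn (s := Ioi 0))
  simp only [RCLike.re_eq_complex_re, re_one_sub_cexp_neg_mul_sq_div_sq] at h
  rw [h, integral_one_sub_cexp_neg_mul_sq_div_sq hre, Complex.re_ofReal_mul,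
    Complex.cpow_inv_two_re, Complex.norm_add_mul_I, ← sqrt_mul pi_pos.le,
    ← sqrt_mul (by positivity)]
  congr 1
  simp
  ring_nf

lemma integral_zero_one_sub_exp_div_sq {a c : ℝ} (ha : 0 ≤ a) (hc : 0 ≤ c) :
    ∫ s in (0:ℝ)..c, (1 - exp (-a * s ^ 2)) / s ^ 2
      = 2 * a * (∫ s in (0:ℝ)..c, exp (-a * s ^ 2)) - (1 - exp (-a * c ^ 2)) / c := by
  have h := integral_zero_one_sub_cexp_neg_mul_sq_div_sq (z := a) (by simpa using ha) hc
  norm_cast at h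
  simp only [intervalIntegral.integral_ofReal] at h
  exact_mod_cast h

lemma mul_sinc_mul_of_ne_zero (c : ℝ) {x : ℝ} (hx : x ≠ 0) :
    c * sinc (c * x) = sin (c * x) / x := by
  rcases eq_or_ne c 0 with rfl | hc
  · simp
  · rw [sinc_of_ne_zero (mul_ne_zero hc hx)]
    field_simp

lemma mul_sinc_mul_mul_cos (b t x : ℝ) :
    b * sinc (b * x) * cos (x * t)
      = ((b + t) * sinc ((b + t) * x) + (b - t) * sinc ((b - t) * x)) / 2 := by
  rcases eq_or_ne x 0 with rfl | hx
  · simp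
  · simp only [mul_sinc_mul_of_ne_zero _ hx]
    rw [add_mul, sub_mul, sin_add, sin_sub, mul_comm x t]
    ring

lemma integral_mul_sinc_mul_one_sub_mul_cos (b e t R : ℝ) :
    ∫ x in (0:ℝ)..R, b * sinc (b * x) * (1 - e * cos (x * t))
      = sineIntegral (b * R)
        - e * ((sineIntegral ((b + t) * R) + sineIntegral ((b - t) * R)) / 2) := by
  have hc (c : ℝ) : IntervalIntegrable (fun x => c * sinc (c * x)) volume 0 R :=
    ((continuous_sinc.comp (continuous_const_mul c)).const_mul c).intervalIntegrable _ _
  have hfun (x : ℝ) : b * sinc (b * x) * (1 - e * cos (x * t)) = b * sinc (b * x)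
      - e * (((b + t) * sinc ((b + t) * x) + (b - t) * sinc ((b - t) * x)) / 2) := by
    rw [← mul_sinc_mul_mul_cos]
    ring
  simp_rw [hfun]
  rw [intervalIntegral.integral_sub (hc _) ((((hc _).add (hc _)).div_const 2).const_mul e),
    intervalIntegral.integral_const_mul e, intervalIntegral.integral_div,
    intervalIntegral.integral_add (hc _) (hc _)]
  simp only [integral_mul_sinc]

lemma abs_sineIntegral_sub_mul_average_le_eight {e : ℝ} (he0 : 0 ≤ e) (he1 : e ≤ 1) (u v w : ℝ) :
    |sineIntegral u - e * ((sineIntegral v + sineIntegral w) / 2)| ≤ 8 := by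
  have hu := abs_le.1 (abs_sineIntegral_le u)
  have hv := abs_le.1 (abs_sineIntegral_le v)
  have hw := abs_le.1 (abs_sineIntegral_le w)
  rw [abs_le]
  constructor <;> nlinarith [hu.1, hu.2, hv.1, hv.2, hw.1, hw.2]

lemma abs_sineIntegral_sub_mul_average_le {a b e t R : ℝ} (ha : 0 ≤ a) (hb : 0 < b) (hR : 0 < R)
    (ht : 0 ≤ t) (he0 : 0 ≤ e) (he1 : e ≤ 1) (he : 1 - e ≤ a * t) :
    |sineIntegral (b * R) - e * ((sineIntegral ((b + t) * R) + sineIntegral ((b - t) * R)) / 2)|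
      ≤ (4 * a + 16 / b) * t := by
  have hat : 0 ≤ a * t := mul_nonneg ha ht
  have htb : 0 ≤ t / b := by positivity
  rw [show (4 * a + 16 / b) * t = 4 * (a * t) + 16 * (t / b) by ring]
  rcases le_total t (b / 2) with h | h
  · have hm : 0 < b / 2 * R := by positivity
    have key (c : ℝ) (hc : |b - c| = t) (hc' : b / 2 ≤ c) :
        |sineIntegral (b * R) - sineIntegral (c * R)| ≤ 2 * (t / b) := by
      refine (abs_sineIntegral_sub_le hm (by gcongr; linarith) (by gcongr)).trans_eq ?_
      rw [← sub_mul, abs_mul, hc, abs_of_pos hR]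
      field_simp
    have h1 := abs_le.1 (key (b + t) (by simp [abs_of_nonneg ht]) (by linarith))
    have h2 := abs_le.1 (key (b - t) (by simp [abs_of_nonneg ht]) (by linarith))
    have h0 := abs_le.1 (abs_sineIntegral_le (b * R))
    set A := sineIntegral (b * R)
    set B := sineIntegral ((b + t) * R)
    set C := sineIntegral ((b - t) * R)
    have hsplit : A - e * ((B + C) / 2) = (1 - e) * A + e * (((A - B) + (A - C)) / 2) := by ring
    have hA : |(1 - e) * A| ≤ a * t * 4 := by
      rw [abs_mul, abs_of_nonneg (sub_nonneg.2 he1)]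
      exact mul_le_mul he (abs_le.2 h0) (abs_nonneg _) hat
    have hBC : |e * (((A - B) + (A - C)) / 2)| ≤ 1 * (2 * (t / b)) := by
      rw [abs_mul, abs_of_nonneg he0]
      refine mul_le_mul he1 (abs_le.2 ⟨?_, ?_⟩) (abs_nonneg _) zero_le_one <;>
        linarith [h1.1, h1.2, h2.1, h2.2]
    rw [hsplit]
    exact (abs_add_le _ _).trans (by linarith)
  · have h2 : 1 / 2 ≤ t / b := by rw [le_div_iff₀ hb]; linarith
    exact (abs_sineIntegral_sub_mul_average_le_eight he0 he1 _ _ _).trans (by linarith)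

lemma tendsto_sineIntegral_sub_mul_average_of_lt {b t : ℝ} (e : ℝ) (ht : 0 ≤ t) (hb : t < b) :
    Tendsto (fun R => sineIntegral (b * R)
        - e * ((sineIntegral ((b + t) * R) + sineIntegral ((b - t) * R)) / 2)) atTop
      (𝓝 (π / 2 * (1 - e))) := by
  have h := (tendsto_sineIntegral_mul_atTop (ht.trans_lt hb)).sub
    ((((tendsto_sineIntegral_mul_atTop (by linarith : 0 < b + t)).add
      (tendsto_sineIntegral_mul_atTop (sub_pos.2 hb))).div_const 2).const_mul e)
  convert h using 2
  ring

lemma tendsto_sineIntegral_sub_mul_average_of_gt {b t : ℝ} (e : ℝ) (hb : 0 < b) (ht : b < t) :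
    Tendsto (fun R => sineIntegral (b * R)
        - e * ((sineIntegral ((b + t) * R) + sineIntegral ((b - t) * R)) / 2)) atTop
      (𝓝 (π / 2)) := by
  have h := (tendsto_sineIntegral_mul_atTop hb).sub
    ((((tendsto_sineIntegral_mul_atTop (by linarith : 0 < b + t)).sub
      (tendsto_sineIntegral_mul_atTop (sub_pos.2 ht))).div_const 2).const_mul e)
  convert h using 2
  · rw [← neg_sub t b, neg_mul, sineIntegral_neg, ← sub_eq_add_neg]
  · ring

lemma one_sub_exp_neg_mul_sq_le (a s : ℝ) : 1 - exp (-a * s ^ 2) ≤ a * s ^ 2 := by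
  linarith [add_one_le_exp (-a * s ^ 2)]

lemma exp_neg_mul_sq_le_one {a : ℝ} (ha : 0 ≤ a) (s : ℝ) : exp (-a * s ^ 2) ≤ 1 :=
  exp_le_one_iff.2 (by nlinarith [sq_nonneg s])

lemma integral_sqrt_div_mul_sin {a b R : ℝ} (ha : 0 < a) (hR : 0 < R) :
    ∫ x in (0:ℝ)..R, √(√(x ^ 2 + a ^ 2) + a) / x * sin (b * x)
      = √(2 / π) * ∫ s in Ioi (0:ℝ), (sineIntegral (b * R) - exp (-a * s ^ 2) *
        ((sineIntegral ((b + s ^ 2) * R) + sineIntegral ((b - s ^ 2) * R)) / 2)) / s ^ 2 := by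
  have hint : Integrable (Function.uncurry fun x s : ℝ =>
      b * sinc (b * x) * ((1 - exp (-a * s ^ 2) * cos (x * s ^ 2)) / s ^ 2))
      ((volume.restrict (Ioc 0 R)).prod (volume.restrict (Ioi 0))) := by
    have hdom : Integrable (fun p : ℝ × ℝ => |b| * (a + R + 2) * (1 + p.2 ^ 2)⁻¹)
        ((volume.restrict (Ioc 0 R)).prod (volume.restrict (Ioi 0))) :=
      (integrable_const _).mul_prod integrable_inv_one_add_sq.integrableOn
    refine hdom.mono' ?_ ?_
    · have := continuous_sinc.measurable
      apply Measurable.aestronglyMeasurable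
      unfold Function.uncurry
      fun_prop
    · rw [Measure.prod_restrict]
      filter_upwards [ae_restrict_mem (measurableSet_Ioc.prod measurableSet_Ioi)] with p hp
      have hx : 0 < p.1 ∧ p.1 ≤ R := hp.1
      simp only [Function.uncurry, norm_mul, norm_eq_abs, mul_assoc]
      refine mul_le_mul_of_nonneg_left ?_ (abs_nonneg b)
      refine (mul_le_of_le_one_left (abs_nonneg _) (abs_sinc_le_one _)).trans
        ((abs_one_sub_exp_mul_cos_div_sq_le ha.le p.1 p.2).trans ?_)
      rw [abs_of_pos hx.1]
      gcongr
      exact hx.2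
  have hswap := integral_integral_swap hint
  simp_rw [integral_const_mul, integral_one_sub_exp_mul_cos_div_sq ha, ← mul_div_assoc,
    integral_div, ← intervalIntegral.integral_of_le hR.le,
    integral_mul_sinc_mul_one_sub_mul_cos] at hswap
  rw [← hswap, intervalIntegral.integral_of_le hR.le, intervalIntegral.integral_of_le hR.le,
    ← integral_const_mul]
  refine setIntegral_congr_fun measurableSet_Ioc fun x hx => ?_
  have h1 : √(2 / π) * √(π / 2) = 1 := by
    rw [← sqrt_mul (by positivity), div_mul_div_cancel₀ pi_ne_zero, div_self two_ne_zero, sqrt_one]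
  simp only [mul_sinc_mul_of_ne_zero b hx.1.ne']
  linear_combination (-(√(√(x ^ 2 + a ^ 2) + a) / x * sin (b * x))) * h1

/-- The pointwise limit, as `R → ∞`, of the integrand of `integral_sqrt_div_mul_sin`. -/
noncomputable def limitIntegrand (a b s : ℝ) : ℝ :=
  if s ≤ √b then π / 2 * ((1 - exp (-a * s ^ 2)) / s ^ 2) else π / 2 * s ^ (-2 : ℝ)

lemma tendsto_integral_sineIntegral {a b : ℝ} (ha : 0 < a) (hb : 0 < b) :
    Tendsto (fun R => ∫ s in Ioi (0:ℝ), (sineIntegral (b * R) - exp (-a * s ^ 2) *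
        ((sineIntegral ((b + s ^ 2) * R) + sineIntegral ((b - s ^ 2) * R)) / 2)) / s ^ 2) atTop
      (𝓝 (∫ s in Ioi (0:ℝ), limitIntegrand a b s)) := by
  refine tendsto_integral_filter_of_dominated_convergence
    (fun s => (4 * a + 16 / b + 8) * (1 + s ^ 2)⁻¹) (Eventually.of_forall fun R => ?_) ?_
    (integrable_inv_one_add_sq.integrableOn.const_mul _) ?_
  · have := continuous_sineIntegral.measurable
    apply Measurable.aestronglyMeasurable
    fun_prop
  · filter_upwards [eventually_gt_atTop 0] with R hR
    refine Eventually.of_forall fun s => ?_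
    rw [norm_div, norm_eq_abs, norm_pow, norm_eq_abs, sq_abs]
    exact div_sq_le_of_le
      (abs_sineIntegral_sub_mul_average_le ha.le hb hR (sq_nonneg s) (exp_pos _).le
        (exp_neg_mul_sq_le_one ha.le s) (one_sub_exp_neg_mul_sq_le a s))
      (abs_sineIntegral_sub_mul_average_le_eight (exp_pos _).le
        (exp_neg_mul_sq_le_one ha.le s) _ _ _)
      (by positivity) (by norm_num)
  · filter_upwards [ae_restrict_mem measurableSet_Ioi,
      ae_restrict_of_ae (Measure.ae_ne volume (√b))] with s hs hne
    have hs : 0 < s := hs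
    rcases lt_or_gt_of_ne hne with h | h
    · rw [limitIntegrand, if_pos h.le, ← mul_div_assoc]
      exact (tendsto_sineIntegral_sub_mul_average_of_lt _ (sq_nonneg s)
        ((lt_sqrt hs.le).1 h)).div_const _
    · rw [limitIntegrand, if_neg h.not_ge, rpow_neg hs.le, rpow_two, ← div_eq_mul_inv]
      exact (tendsto_sineIntegral_sub_mul_average_of_gt _ hb
        ((sqrt_lt' hs).1 h)).div_const _

lemma integral_exp_neg_mul_sq {a : ℝ} (ha : 0 < a) (c : ℝ) :
    ∫ s in (0:ℝ)..c, exp (-a * s ^ 2) = √π / (2 * √a) * erf (√a * c) := by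
  have h := intervalIntegral.mul_integral_comp_mul_left (a := 0) (b := c)
    (f := fun u => exp (-u ^ 2)) (√a)
  simp only [mul_pow, sq_sqrt ha.le, mul_zero, ← neg_mul] at h
  have ha' : √a ≠ 0 := (sqrt_pos.2 ha).ne'
  have hπ : √π ≠ 0 := (sqrt_pos.2 pi_pos).ne'
  rw [erf]
  simp only [neg_mul] at h ⊢
  rw [← h]
  field_simp

lemma integral_limitIntegrand {a b : ℝ} (ha : 0 < a) (hb : 0 < b) :
    ∫ s in Ioi (0:ℝ), limitIntegrand a b s
      = π / 2 * (exp (-(a * b)) / √b + √a * √π * erf (√(a * b))) := by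
  have hb' : 0 < √b := sqrt_pos.2 hb
  have h1 : EqOn (limitIntegrand a b) (fun s => π / 2 * ((1 - exp (-a * s ^ 2)) / s ^ 2))
      (Ioc 0 √b) := fun s hs => if_pos hs.2
  have h2 : EqOn (limitIntegrand a b) (fun s => π / 2 * s ^ (-2 : ℝ)) (Ioi √b) :=
    fun s hs => if_neg (not_le.2 hs)
  have i1 : IntegrableOn (fun s => π / 2 * ((1 - exp (-a * s ^ 2)) / s ^ 2)) (Ioc 0 √b) := by
    refine Integrable.const_mul (Integrable.mono'
      (integrable_inv_one_add_sq.integrableOn.const_mul (a + 2))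
      (by apply Measurable.aestronglyMeasurable; fun_prop)
      (Eventually.of_forall fun s => ?_)) _
    simpa [abs_div] using abs_one_sub_exp_mul_cos_div_sq_le ha.le 0 s
  have i2 : IntegrableOn (fun s : ℝ => π / 2 * s ^ (-2 : ℝ)) (Ioi √b) :=
    (integrableOn_Ioi_rpow_of_lt (by norm_num) hb').const_mul _
  rw [← Ioc_union_Ioi_eq_Ioi hb'.le, setIntegral_union Ioc_disjoint_Ioi_same measurableSet_Ioi
    (i1.congr_fun h1.symm measurableSet_Ioc) (i2.congr_fun h2.symm measurableSet_Ioi),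
    setIntegral_congr_fun measurableSet_Ioc h1, setIntegral_congr_fun measurableSet_Ioi h2,
    integral_const_mul, integral_const_mul, ← intervalIntegral.integral_of_le hb'.le,
    integral_zero_one_sub_exp_div_sq ha.le hb'.le, integral_exp_neg_mul_sq ha,
    integral_Ioi_rpow_of_lt (by norm_num) hb', sq_sqrt hb.le, sqrt_mul ha.le, neg_mul,
    show (-2 : ℝ) + 1 = -1 by norm_num, rpow_neg_one]
  have ha' : √a ≠ 0 := (sqrt_pos.2 ha).ne'
  have hsq : a = √a * √a := (mul_self_sqrt ha.le).symm
  have : 2 * a * (√π / (2 * √a) * erf (√a * √b)) = √a * √π * erf (√a * √b) := by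
    nth_rw 1 [hsq]
    field_simp
  rw [this]
  field_simp
  ring

theorem stmt19 (a b : ℝ) (ha : 0 < a) (hb : 0 < b) :
    Tendsto (fun R : ℝ => ∫ x in (0:ℝ)..R,
        Real.sqrt (Real.sqrt (x^2 + a^2) + a) / x * Real.sin (b * x))
      atTop
      (nhds (Real.sqrt (π / (2 * b)) * Real.exp (-(a * b))
        + Real.sqrt (a / 2) * π * erf (Real.sqrt (a * b)))) := by
  have h := (tendsto_integral_sineIntegral ha hb).const_mul √(2 / π)
  rw [integral_limitIntegrand ha hb] at h
  have hlim : √(2 / π) * (π / 2 * (exp (-(a * b)) / √b + √a * √π * erf √(a * b)))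
      = √(π / (2 * b)) * exp (-(a * b)) + √(a / 2) * π * erf √(a * b) := by
    have hπ : √π ≠ 0 := (sqrt_pos.2 pi_pos).ne'
    have hb' : √b ≠ 0 := (sqrt_pos.2 hb).ne'
    have h2 : √2 ≠ 0 := (sqrt_pos.2 two_pos).ne'
    have hπ2 : √π ^ 2 = π := sq_sqrt pi_pos.le
    have h22 : √2 ^ 2 = 2 := sq_sqrt zero_le_two
    rw [sqrt_div zero_le_two, sqrt_div pi_pos.le, sqrt_mul zero_le_two, sqrt_div ha.le,
      ← hπ2, sqrt_sq (sqrt_nonneg π)]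
    field_simp
    rw [h22]
  rw [hlim] at h
  refine h.congr' ?_
  filter_upwards [eventually_gt_atTop 0] with R hR
  exact (integral_sqrt_div_mul_sin ha hR).symm
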